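/- For real analytic functions f : Ω ⊆ ℝ^{p+q+1} → ℝ_{p+q} with suitable integrability, the Radon transform and its dual intertwine the relevant Dirac-type operators: \check{R}[D_ω f] = D_𝐱 ( \check{R}[f] ) and R[D_𝐱 f] = D_ω ( R[f] ), where D_ω = D_{𝐱_p} + ω∂_r. -/

import Mathlib

/-!
Common framework for generalized partial-slice monogenic functions
(Xu–Sabadini, "On the Fueter-Sce theorem for generalized partial-slice
monogenic functions").

The real Clifford algebra `ℝ_{p+q}` is formalized as the Mathlib Clifford
algebra of the negative-definite quadratic form on `ℝ^{p+q}`; since Mathlib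
provides no canonical norm on it, all analytic statements are phrased for an
arbitrary normed real algebra `A` together with an `ℝ`-algebra isomorphism
`ξ : A ≃ₐ[ℝ] Cl (p+q)`.  A point of `ℝ^{p+q+1}` is a pair
`(𝐱_p, 𝐱_q) : (Fin (p+1) → ℝ) × EuclideanSpace ℝ (Fin q)`, and a point of a
slice `ℝ^{p+2}` is a pair `(𝐱_p, r)`.
-/

noncomputable section

open Filter Topology MeasureTheory Metric
open scoped Nat RealInnerProductSpace

namespace GPS

/-- The negative definite quadratic form `-(x₁² + ⋯ + xₙ²)` on `ℝⁿ`. -/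
def Qe (n : ℕ) : QuadraticForm ℝ (Fin n → ℝ) :=
  QuadraticMap.weightedSumSquares ℝ (fun _ : Fin n => (-1 : ℝ))

/-- The real Clifford algebra `ℝ_n`. -/
abbrev Cl (n : ℕ) : Type := CliffordAlgebra (Qe n)

/-- The generators `e_1, …, e_n` of `ℝ_n` (indexed by `Fin n`). -/
def e (n : ℕ) (i : Fin n) : Cl n := CliffordAlgebra.ι (Qe n) (Pi.single i 1)

variable (p q : ℕ)

/-- `ℝ^{p+1}`, the "slice-axis" space. -/
abbrev Vp : Type := Fin (p + 1) → ℝ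

/-- `ℝ^q`. -/
abbrev Vq : Type := EuclideanSpace ℝ (Fin q)

/-- `ℝ^{p+q+1} = ℝ^{p+1} ⊕ ℝ^q`. -/
abbrev V : Type := Vp p × Vq q

/-- `ℝ^{p+2}`, the parameter space `(𝐱_p, r)` of a slice. -/
abbrev Sl : Type := Vp p × ℝ

/-- The sphere `𝕊` of unit 1-vectors, described by their coordinate vectors
`(x_{p+1}, …, x_{p+q}) ∈ ℝ^q` with `∑ x_i² = 1`. -/
def S : Set (Vq q) := {v | ∑ j, v j ^ 2 = 1}

/-- The point `𝐱_p + r ω` of `ℝ^{p+q+1}`. -/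
def spt (v : Vq q) (z : Sl p) : V p q := (z.1, z.2 • v)

/-- The (parameterized) slice `Ω_ω` of a set `Ω ⊆ ℝ^{p+q+1}`. -/
def sliceSet (Ω : Set (V p q)) (v : Vq q) : Set (Sl p) := {z | spt p q v z ∈ Ω}

/-- `Ω₀* = {𝐱_p + 𝐱_q : 𝐱_p ∈ Ω₀, 𝐱_q ∈ ℝ^q}`. -/
def star0 (Ω₀ : Set (Vp p)) : Set (V p q) := {z | z.1 ∈ Ω₀}

/-- The p-symmetric completion `Ω_D` of a set `D ⊆ ℝ^{p+2}`. -/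
def completion (D : Set (Sl p)) : Set (V p q) :=
  {x | ∃ z ∈ D, ∃ v ∈ S q, x = spt p q v z}

/-- `D` is invariant under the reflection of the `(p+2)`-th variable. -/
def ReflInv (D : Set (Sl p)) : Prop := ∀ z ∈ D, ((z.1, -z.2) : Sl p) ∈ D

/-- A domain: a nonempty open connected set. -/
def IsDomain {E : Type*} [TopologicalSpace E] (s : Set E) : Prop :=
  IsOpen s ∧ IsConnected s

/-- A slice domain. -/
def IsSliceDomain (Ω : Set (V p q)) : Prop :=
  IsDomain Ω ∧ (∃ x : Vp p, ((x, 0) : V p q) ∈ Ω) ∧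
    ∀ v ∈ S q, IsDomain (sliceSet p q Ω v)

/-- Partial symmetry with respect to `ℝ^{p+1}`. -/
def IsPSymmetric (Ω : Set (V p q)) : Prop :=
  ∀ (x : Vp p) (r : ℝ), ∀ v ∈ S q, ∀ w ∈ S q,
    ((x, r • v) : V p q) ∈ Ω → ((x, r • w) : V p q) ∈ Ω

/-- A `d`-dimensional smooth submanifold of a real normed space. -/
def IsSmoothSubmanifoldDim {E : Type*} [NormedAddCommGroup E] [NormedSpace ℝ E]
    (d : ℕ) (M : Set E) : Prop :=
  ∀ x ∈ M, ∃ U : Set E, IsOpen U ∧ x ∈ U ∧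
    ∃ (ψ : (Fin d → ℝ) → E) (W : Set (Fin d → ℝ)), IsOpen W ∧
      ContDiffOn ℝ (⊤ : ℕ∞) ψ W ∧ Set.InjOn ψ W ∧
      (∀ y ∈ W, Function.Injective (fderivWithin ℝ ψ W y)) ∧
      M ∩ U = ψ '' W

variable {A : Type*} [NormedRing A] [NormedAlgebra ℝ A] (ξ : A ≃ₐ[ℝ] Cl (p + q))

/-- The generators `e_1, …, e_{p+q}` inside `A`. -/
def gen (i : Fin (p + q)) : A := ξ.symm (e (p + q) i)

/-- The generators `e_{p+1}, …, e_{p+q}` (the "q-part"). -/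
def eQ (j : Fin q) : A := gen p q ξ ⟨p + (j : ℕ), by have := j.isLt; omega⟩

/-- The generators `e_1, …, e_p` (the "p-part", without `e_0 = 1`). -/
def eP (i : Fin p) : A := gen p q ξ ⟨(i : ℕ), by have := i.isLt; omega⟩

/-- `e_0 = 1, e_1, …, e_p`: the paravector basis of `ℝ^{p+1}` inside `A`. -/
def εp (i : Fin (p + 1)) : A :=
  if h : (i : ℕ) = 0 then 1 else gen p q ξ ⟨(i : ℕ) - 1, by have := i.isLt; omega⟩

/-- The 1-vector `∑ x_i e_{p+i} ∈ A` corresponding to `𝐱_q ∈ ℝ^q`;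
for a unit `v` this is the imaginary unit `ω ∈ 𝕊`. -/
def ωCl (v : Vq q) : A := ∑ j, v j • eQ p q ξ j

/-- The paravector `x_0 + x_1 e_1 + ⋯ + x_p e_p ∈ A` of `𝐱_p ∈ ℝ^{p+1}`. -/
def clP (x : Vp p) : A := ∑ i, x i • εp p q ξ i

/-- The paravector of `𝐱 ∈ ℝ^{p+q+1}` in `A`. -/
def toCl (z : V p q) : A := clP p q ξ z.1 + ωCl p q ξ z.2

section SliceOperators

variable {F' : Type*} [NormedAddCommGroup F'] [NormedSpace ℝ F']

/-- `∂_{x_i}` on functions on `ℝ^{p+2}`. -/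
def pdSl (i : Fin (p + 1)) (F : Sl p → F') : Sl p → F' :=
  fun z => fderiv ℝ F z (Pi.single i 1, 0)

/-- `∂_r` on functions on `ℝ^{p+2}`. -/
def pdr (F : Sl p → F') : Sl p → F' := fun z => fderiv ℝ F z (0, 1)

/-- `∂_{x_i}` (first factor) on functions on `ℝ^{p+q+1}`. -/
def pdV1 (i : Fin (p + 1)) (f : V p q → F') : V p q → F' :=
  fun z => fderiv ℝ f z ((Pi.single i 1 : Vp p), 0)

/-- `∂_{x_{p+j}}` (second factor) on functions on `ℝ^{p+q+1}`. -/
def pdV2 (j : Fin q) (f : V p q → F') : V p q → F' :=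
  fun z => fderiv ℝ f z (0, EuclideanSpace.single j 1)

/-- `∂_{x_i}` on functions on `ℝ^{p+1}`. -/
def pdP (i : Fin (p + 1)) (g : Vp p → F') : Vp p → F' :=
  fun x => fderiv ℝ g x (Pi.single i 1)

/-- The Laplacian `Δ_{𝐱'} = Δ_{𝐱_p} + ∂_r²` on `ℝ^{p+2}`. -/
def LapSl (F : Sl p → F') : Sl p → F' :=
  fun z => ∑ i, pdSl p (i := i) (pdSl p i F) z + pdr p (pdr p F) z

/-- The Laplacian `Δ_𝐱` on `ℝ^{p+q+1}`. -/
def LapV (f : V p q → F') : V p q → F' :=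
  fun z => ∑ i, pdV1 p q i (pdV1 p q i f) z + ∑ j, pdV2 p q j (pdV2 p q j f) z

/-- The Laplacian `Δ_{𝐱_p}` on `ℝ^{p+1}`. -/
def LapP (g : Vp p → F') : Vp p → F' :=
  fun x => ∑ i, pdP p i (pdP p i g) x

end SliceOperators

/-- The generalized Cauchy–Riemann operator `D_{𝐱_p} = ∑_{i=0}^p e_i ∂_{x_i}`
on slice functions. -/
def DP (F : Sl p → A) : Sl p → A :=
  fun z => ∑ i, εp p q ξ i * pdSl p i F z

/-- The conjugated operator `D̄_{𝐱_p} = ∂_{x_0} - ∑_{i=1}^p e_i ∂_{x_i}`. -/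
def DPbar (F : Sl p → A) : Sl p → A :=
  fun z => pdSl p 0 F z - ∑ i : Fin p, eP p q ξ i * pdSl p i.succ F z

/-- The generalized Cauchy–Riemann (Dirac) operator `D_𝐱` on `ℝ^{p+q+1}`. -/
def DV (f : V p q → A) : V p q → A :=
  fun z => ∑ i, εp p q ξ i * pdV1 p q i f z + ∑ j, eQ p q ξ j * pdV2 p q j f z

/-- `D_{𝐱_p} = ∑_{i=0}^p e_i ∂_{x_i}` on functions on `ℝ^{p+1}`. -/
def DPfun (g : Vp p → A) : Vp p → A :=
  fun x => ∑ i, εp p q ξ i * pdP p i g x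

/-- The slice operator `D_ω = D_{𝐱_p} + ω ∂_r`, expressed on `ℝ^{p+q+1} ∖ ℝ^{p+1}`
(at `𝐱_q = 0` the radial part is junk `0`). -/
def Dslice (f : V p q → A) : V p q → A :=
  fun z => ∑ i, εp p q ξ i * pdV1 p q i f z
    + ωCl p q ξ (‖z.2‖⁻¹ • z.2) * fderiv ℝ f z (0, ‖z.2‖⁻¹ • z.2)

/-- The spherical Dirac operator `Γ = -∑_{i<j} e_i e_j L_{ij}` on the `ℝ^q` variables. -/
def sphericalDirac (f : V p q → A) : V p q → A :=
  fun z => - ∑ i : Fin q, ∑ j : Fin q,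
    if (i : ℕ) < (j : ℕ) then
      eQ p q ξ i * eQ p q ξ j *
        (z.2 i • pdV2 p q j f z - z.2 j • pdV2 p q i f z)
    else 0

/-- `f` is left generalized partial-slice monogenic of type `(p,q)` on `Ω`. -/
def GSMOn (Ω : Set (V p q)) (f : V p q → A) : Prop :=
  ∀ v ∈ S q,
    ContDiffOn ℝ 1 (fun z => f (spt p q v z)) (sliceSet p q Ω v) ∧
    ∀ z ∈ sliceSet p q Ω v,
      DP p q ξ (fun w => f (spt p q v w)) z
        + ωCl p q ξ v * pdr p (fun w => f (spt p q v w)) z = 0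

/-- `f` is (left) monogenic on `Ω`. -/
def MonogenicOn (Ω : Set (V p q)) (f : V p q → A) : Prop :=
  ContDiffOn ℝ 1 f Ω ∧ ∀ z ∈ Ω, DV p q ξ f z = 0

/-- `f` is the generalized partial-slice function on `Ω_D` with components `F1, F2`
(an even–odd pair in the last variable). -/
def IsGPSlice (D : Set (Sl p)) (f : V p q → A) (F1 F2 : Sl p → A) : Prop :=
  (∀ z ∈ D, F1 (z.1, -z.2) = F1 z ∧ F2 (z.1, -z.2) = -F2 z) ∧
  ∀ z ∈ D, ∀ v ∈ S q, f (spt p q v z) = F1 z + ωCl p q ξ v * F2 z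

/-- The generalized Cauchy–Riemann system (2.6) for the pair `(F1, F2)`. -/
def CRSystem (D : Set (Sl p)) (F1 F2 : Sl p → A) : Prop :=
  ∀ z ∈ D, DP p q ξ F1 z - pdr p F2 z = 0 ∧ DPbar p q ξ F2 z + pdr p F1 z = 0

/-- `f ∈ 𝒢𝒮ℛ(Ω_D)` with the given components. -/
def GSROnWith (D : Set (Sl p)) (f : V p q → A) (F1 F2 : Sl p → A) : Prop :=
  IsGPSlice p q ξ D f F1 F2 ∧ ContDiffOn ℝ 1 F1 D ∧ ContDiffOn ℝ 1 F2 D ∧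
    CRSystem p q ξ D F1 F2

/-- `f ∈ 𝒢𝒮ℛ(Ω_D)`. -/
def GSROn (D : Set (Sl p)) (f : V p q → A) : Prop :=
  ∃ F1 F2, GSROnWith p q ξ D f F1 F2

/-- Iterates `((1/r) ∂_r)^k F`. -/
def AIter (F : Sl p → A) : ℕ → Sl p → A
  | 0 => F
  | k + 1 => fun z => z.2⁻¹ • pdr p (AIter F k) z

/-- Iterates `(∂_r (1/r))^k F`. -/
def BIter (F : Sl p → A) : ℕ → Sl p → A
  | 0 => F
  | k + 1 => fun z => fderiv ℝ (fun w : Sl p => w.2⁻¹ • BIter F k w) z (0, 1)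

/-- `C_q(k) = (q-1)(q-3)⋯(q-2k+1)`. -/
def Cq (k : ℕ) : ℝ := ∏ j ∈ Finset.range k, ((q : ℝ) - (2 * (j : ℝ) + 1))

/-- The Fueter–Sce map `τ_q = (1/(q-1)!!) Δ^{(q-1)/2}` (for odd `q`). -/
def tauq (f : V p q → A) : V p q → A :=
  fun z => (((q - 1)‼ : ℝ))⁻¹ • (LapV p q)^[(q - 1) / 2] f z

/-- `(𝐱_q D_{𝐱_p})^k`, for a fixed Clifford element `u` in place of `𝐱_q`. -/
def uDpow (u : A) : ℕ → (Vp p → A) → Vp p → A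
  | 0 => fun g => g
  | k + 1 => fun g x => u * DPfun p q ξ (uDpow u k g) x

/-- The `k`-th term of the slice Cauchy–Kovalevskaya extension series. -/
def ckTerm (f₀ : Vp p → A) (k : ℕ) (z : V p q) : A :=
  ((k ! : ℝ))⁻¹ • uDpow p q ξ (ωCl p q ξ z.2) k f₀ z.1

/-- The slice Cauchy–Kovalevskaya extension `CK[f₀]`. -/
def CKext (f₀ : Vp p → A) (z : V p q) : A := ∑' k, ckTerm p q ξ f₀ k z

/-- The `k`-th term of the CK-extension for a fixed direction `w`. -/
def ckDirTerm (w : Vq q) (f₀ : Vp p → A) (k : ℕ) (z : V p q) : A :=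
  ((⟪w, z.2⟫) ^ k / (k ! : ℝ)) • uDpow p q ξ (ωCl p q ξ w) k f₀ z.1

/-- The CK-extension for a fixed direction `w ∈ 𝕊`. -/
def CKdir (w : Vq q) (f₀ : Vp p → A) (z : V p q) : A :=
  ∑' k, ckDirTerm p q ξ w f₀ k z

/-- The coefficients of the generalized CK-extension:
`f_{2k} = (Γ(q/2) / (2^{2k} k! Γ(k+q/2))) Δ^k f₀` and
`f_{2k+1} = (Γ(q/2) / (2^{2k+1} k! Γ(k+q/2+1))) D Δ^k f₀`. -/
def gckCoeff (f₀ : Vp p → A) (k : ℕ) : Vp p → A :=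
  if k % 2 = 0 then
    fun x => (Real.Gamma ((q : ℝ) / 2) /
        (2 ^ k * ((k / 2)! : ℝ) * Real.Gamma (((k / 2 : ℕ) : ℝ) + (q : ℝ) / 2))) •
      (LapP p)^[k / 2] f₀ x
  else
    fun x => (Real.Gamma ((q : ℝ) / 2) /
        (2 ^ k * ((k / 2)! : ℝ) * Real.Gamma (((k / 2 : ℕ) : ℝ) + (q : ℝ) / 2 + 1))) •
      DPfun p q ξ ((LapP p)^[k / 2] f₀) x

/-- The `k`-th term `𝐱_q^k f_k(𝐱_p)` of the generalized CK-extension series. -/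
def gckTerm (f₀ : Vp p → A) (k : ℕ) (z : V p q) : A :=
  (ωCl p q ξ z.2) ^ k * gckCoeff p q ξ f₀ k z.1

/-- The generalized CK-extension `GCK[f₀]`. -/
def GCKext (f₀ : Vp p → A) (z : V p q) : A := ∑' k, gckTerm p q ξ f₀ k z

/-- The Radon transform `R[f](𝐱_p, r, ω) = ∫_{⟨𝐱_q,ω⟩=r} f(𝐱_p, 𝐱_q) dσ(𝐱_q)`. -/
def radon (f : V p q → A) (x : Vp p) (r : ℝ) (w : Vq q) : A :=
  ∫ u : ((Submodule.span ℝ {w})ᗮ : Submodule ℝ (Vq q)),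
    f (x, r • w + (u : Vq q))

/-- The (suitably normalized) surface measure on the unit sphere of `ℝ^q`. -/
def sphMeasure : Measure (sphere (0 : Vq q) 1) := volume.toSphere

/-- The dual Radon transform
`Ř[f](𝐱_p, 𝐱_q) = (1/A_q) ∫_𝕊 f(𝐱_p, ⟨𝐱_q, η⟩ η) dS(η)` (a spherical average). -/
def dualRadon (f : V p q → A) (z : V p q) : A :=
  ⨍ w : sphere (0 : Vq q) 1,
    f (z.1, (⟪((w : Vq q)), z.2⟫) • (w : Vq q)) ∂(sphMeasure q)

end GPS

open GPS

/-- Differentiation under the integral sign over a compact space carrying a finite measure. -/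
theorem hasFDerivAt_integral_of_continuous_of_compactSpace
    {K E G : Type*} [TopologicalSpace K] [CompactSpace K] [SecondCountableTopology K]
    [MeasurableSpace K] [OpensMeasurableSpace K] (μ : Measure K) [IsFiniteMeasure μ]
    [NormedAddCommGroup E] [NormedSpace ℝ E] [ProperSpace E]
    [NormedAddCommGroup G] [NormedSpace ℝ G]
    {F : E → K → G} {F' : E → K → E →L[ℝ] G}
    (hF : Continuous fun y : E × K => F y.1 y.2) (hF' : Continuous fun y : E × K => F' y.1 y.2)
    (hd : ∀ x k, HasFDerivAt (fun y => F y k) (F' x k) x) (x₀ : E) :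
    HasFDerivAt (fun x => ∫ k, F x k ∂μ) (∫ k, F' x₀ k ∂μ) x₀ := by
  obtain ⟨C, hC⟩ := ((isCompact_closedBall x₀ 1).prod
    (isCompact_univ (X := K))).exists_bound_of_continuousOn hF'.continuousOn
  have hFc (x : E) : Continuous (F x) := hF.comp (by fun_prop : Continuous fun k => (x, k))
  have hF'c (x : E) : Continuous (F' x) := hF'.comp (by fun_prop : Continuous fun k => (x, k))
  have hInt : Integrable (F x₀) μ := by
    obtain ⟨M, hM⟩ := (isCompact_univ (X := K)).exists_bound_of_continuousOn
      (hFc x₀).continuousOn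
    exact Integrable.of_bound (hFc x₀).aestronglyMeasurable M
      (.of_forall fun k => hM k (Set.mem_univ k))
  exact hasFDerivAt_integral_of_dominated_of_fderiv_le (bound := fun _ => C)
    (closedBall_mem_nhds x₀ one_pos)
    (.of_forall fun x => (hFc x).aestronglyMeasurable) hInt
    (hF'c x₀).aestronglyMeasurable
    (.of_forall fun k x hx => hC (x, k) ⟨hx, Set.mem_univ k⟩)
    (integrable_const C) (.of_forall fun k x _ => hd x k)

/-- The integral over the whole space of a directional derivative vanishes. -/
theorem integral_hasLineDerivAt_eq_zero {E G : Type*} [NormedAddCommGroup E] [NormedSpace ℝ E]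
    [FiniteDimensional ℝ E] [MeasurableSpace E] [BorelSpace E] (μ : Measure E)
    [μ.IsAddHaarMeasure] [NormedAddCommGroup G] [NormedSpace ℝ G] {g g' : E → G} {v : E}
    (hg : Integrable g μ) (hg' : Integrable g' μ)
    (hd : ∀ x, HasLineDerivAt ℝ g (g' x) x v) : ∫ x, g' x ∂μ = 0 := by
  have h := integral_bilinear_hasLineDerivAt_right_eq_neg_left_of_integrable (μ := μ)
    (f := fun _ : E => (1 : ℝ)) (f' := fun _ => 0) (g := g) (g' := g') (v := v)
    (B := ContinuousLinearMap.lsmul ℝ ℝ) (by simp) (by simpa using hg') (by simpa using hg)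
    (fun x _ => by simpa [HasLineDerivAt] using hasDerivAt_const (0 : ℝ) (1 : ℝ))
    (fun x _ => hd x)
  simpa using h

namespace GPS

variable {p q : ℕ} {A : Type*} [NormedRing A] [NormedAlgebra ℝ A] (ξ : A ≃ₐ[ℝ] Cl (p + q))

instance : IsFiniteMeasure (sphMeasure q) :=
  inferInstanceAs (IsFiniteMeasure (volume : Measure (Vq q)).toSphere)

theorem norm_eq_one_of_mem_S {w : Vq q} (hw : w ∈ S q) : ‖w‖ = 1 := by
  have h : ∑ j, w j ^ 2 = 1 := hw
  simp [EuclideanSpace.norm_eq, h]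

theorem ωCl_smul (c : ℝ) (v : Vq q) : ωCl p q ξ (c • v) = c • ωCl p q ξ v := by
  simp [ωCl, Finset.smul_sum, mul_smul]

theorem ωCl_mul_eq_sum (v : Vq q) (a : A) :
    ωCl p q ξ v * a = ∑ j, eQ p q ξ j * v j • a := by
  simp [ωCl, Finset.sum_mul]

theorem apply_inl_eq_sum {G : Type*} [NormedAddCommGroup G] [NormedSpace ℝ G]
    (L : V p q →L[ℝ] G) (x : Vp p) :
    L (x, 0) = ∑ i, x i • L (Pi.single i 1, 0) := by
  have h := LinearMap.pi_apply_eq_sum_univ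
    (L.comp (ContinuousLinearMap.inl ℝ (Vp p) (Vq q))).toLinearMap x
  have hs (i : Fin (p + 1)) :
      (fun j => if i = j then (1 : ℝ) else 0) = Pi.single i 1 := by
    ext j; simp [Pi.single_apply, eq_comm]
  simpa [hs] using h

theorem apply_inr_eq_sum {G : Type*} [NormedAddCommGroup G] [NormedSpace ℝ G]
    (L : V p q →L[ℝ] G) (v : Vq q) :
    L (0, v) = ∑ j, v j • L (0, EuclideanSpace.single j 1) := by
  have hv := (EuclideanSpace.basisFun (Fin q) ℝ).sum_repr v
  have h : L.comp (ContinuousLinearMap.inr ℝ (Vp p) (Vq q)) v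
      = ∑ j, v j • L.comp (ContinuousLinearMap.inr ℝ (Vp p) (Vq q))
        (EuclideanSpace.single j 1) := by
    conv_lhs => rw [← hv]
    simp only [map_sum, map_smul, EuclideanSpace.basisFun_repr, EuclideanSpace.basisFun_apply]
  simpa using h

/-- A linear map on `ℝ^{p+q+1}` is bounded by its values on the standard basis. -/
theorem norm_apply_le_of_basis_le {G : Type*} [NormedAddCommGroup G] [NormedSpace ℝ G]
    (L : V p q →L[ℝ] G) {C : ℝ} (hP : ∀ i : Fin (p + 1), ‖L (Pi.single i 1, 0)‖ ≤ C)
    (hQ : ∀ j : Fin q, ‖L (0, EuclideanSpace.single j 1)‖ ≤ C) (z : V p q) :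
    ‖L z‖ ≤ (p + 1 + q) * C * ‖z‖ := by
  have hz : L z = L (z.1, 0) + L (0, z.2) := by rw [← map_add]; simp
  have hC : 0 ≤ C := (norm_nonneg _).trans (hP 0)
  have h1 : ‖L (z.1, 0)‖ ≤ (p + 1) * (‖z‖ * C) := by
    rw [apply_inl_eq_sum]
    calc _ ≤ ∑ _i : Fin (p + 1), ‖z‖ * C := norm_sum_le_of_le _ fun i _ => by
            rw [norm_smul]
            exact mul_le_mul ((norm_le_pi_norm z.1 i).trans (norm_fst_le z)) (hP i)
              (norm_nonneg _) (norm_nonneg _)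
      _ = _ := by simp
  have h2 : ‖L (0, z.2)‖ ≤ q * (‖z‖ * C) := by
    rw [apply_inr_eq_sum]
    calc _ ≤ ∑ _j : Fin q, ‖z‖ * C := norm_sum_le_of_le _ fun j _ => by
            rw [norm_smul]
            exact mul_le_mul ((PiLp.norm_apply_le z.2 j).trans (norm_snd_le z)) (hQ j)
              (norm_nonneg _) (norm_nonneg _)
      _ = _ := by simp
  calc ‖L z‖ ≤ ‖L (z.1, 0)‖ + ‖L (0, z.2)‖ := hz ▸ norm_add_le _ _
    _ ≤ _ := by linarith

/-- The linear map `𝐱 ↦ 𝐱_p + ⟨𝐱_q, w⟩ w`. -/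
def lineProj (w : Vq q) : V p q →L[ℝ] V p q :=
  (ContinuousLinearMap.inl ℝ (Vp p) (Vq q)).comp (ContinuousLinearMap.fst ℝ (Vp p) (Vq q)) +
    ((innerSL ℝ w).comp (ContinuousLinearMap.snd ℝ (Vp p) (Vq q))).smulRight ((0 : Vp p), w)

@[simp]
theorem lineProj_apply (w : Vq q) (z : V p q) : lineProj w z = (z.1, ⟪w, z.2⟫ • w) := by
  simp [lineProj]

theorem continuous_lineProj : Continuous (lineProj (p := p) (q := q)) := by
  unfold lineProj
  fun_prop

/-- The linear map `(𝐱_p, r) ↦ 𝐱_p + r w`. -/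
def sliceMap (w : Vq q) : Sl p →L[ℝ] V p q :=
  (ContinuousLinearMap.inl ℝ (Vp p) (Vq q)).comp (ContinuousLinearMap.fst ℝ (Vp p) ℝ) +
    (ContinuousLinearMap.snd ℝ (Vp p) ℝ).smulRight ((0 : Vp p), w)

@[simp]
theorem sliceMap_apply (w : Vq q) (z : Sl p) : sliceMap w z = (z.1, z.2 • w) := by
  simp [sliceMap]

theorem hasFDerivAt_dualRadon {f : V p q → A} (hf : ContDiff ℝ 1 f) (z : V p q) :
    HasFDerivAt (dualRadon p q f)
      (((sphMeasure q).real Set.univ)⁻¹ • ∫ w : sphere (0 : Vq q) 1,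
        (fderiv ℝ f (lineProj w z)).comp (lineProj (w : Vq q)) ∂(sphMeasure q)) z := by
  have hl : Continuous fun y : V p q × sphere (0 : Vq q) 1 => lineProj (p := p) (y.2 : Vq q) :=
    continuous_lineProj.comp (continuous_subtype_val.comp continuous_snd)
  have hc : Continuous fun y : V p q × sphere (0 : Vq q) 1 => lineProj (y.2 : Vq q) y.1 :=
    hl.clm_apply continuous_fst
  have hF : Continuous fun y : V p q × sphere (0 : Vq q) 1 =>
      f (lineProj (y.2 : Vq q) y.1) := hf.continuous.comp hc
  have hF' : Continuous fun y : V p q × sphere (0 : Vq q) 1 =>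
      (fderiv ℝ f (lineProj (y.2 : Vq q) y.1)).comp (lineProj (y.2 : Vq q)) :=
    ((hf.continuous_fderiv one_ne_zero).comp hc).clm_comp hl
  have h := hasFDerivAt_integral_of_continuous_of_compactSpace (sphMeasure q)
    (F := fun (y : V p q) (w : sphere (0 : Vq q) 1) => f (lineProj (w : Vq q) y))
    (F' := fun (y : V p q) (w : sphere (0 : Vq q) 1) =>
      (fderiv ℝ f (lineProj (w : Vq q) y)).comp (lineProj (w : Vq q)))
    hF hF' (fun y w => (hf.differentiable one_ne_zero _).hasFDerivAt.comp y
      (lineProj (w : Vq q)).hasFDerivAt) z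
  have he : dualRadon p q f = fun y => ((sphMeasure q).real Set.univ)⁻¹ •
      ∫ w : sphere (0 : Vq q) 1, f (lineProj (w : Vq q) y) ∂(sphMeasure q) := by
    ext y
    simp [dualRadon, average_eq]
  rw [he]
  exact h.const_smul (((sphMeasure q).real Set.univ)⁻¹ : ℝ)

/-- Great subspheres are null sets. -/
theorem ae_inner_ne_zero {v : Vq q} (hv : v ≠ 0) :
    ∀ᵐ w : sphere (0 : Vq q) 1 ∂(sphMeasure q), ⟪(w : Vq q), v⟫ ≠ 0 := by
  have hm : MeasurableSet {w : sphere (0 : Vq q) 1 | ⟪(w : Vq q), v⟫ = 0} :=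
    (isClosed_eq (by fun_prop) continuous_const).measurableSet
  rw [ae_iff]
  simp only [ne_eq, not_not]
  rw [sphMeasure, Measure.toSphere_apply' _ hm]
  have hne : (ℝ ∙ v)ᗮ ≠ ⊤ := by
    intro h
    have : v ∈ (ℝ ∙ v)ᗮ := h ▸ Submodule.mem_top
    rw [Submodule.mem_orthogonal_singleton_iff_inner_left] at this
    exact hv (inner_self_eq_zero.mp this)
  rw [measure_mono_null _ (Measure.addHaar_submodule volume _ hne), mul_zero]
  rintro _ ⟨c, -, _, ⟨w, hw, rfl⟩, rfl⟩
  have hw' : ⟪(w : Vq q), v⟫ = 0 := hw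
  simp [Submodule.mem_orthogonal_singleton_iff_inner_left, inner_smul_left, hw']

theorem Dslice_smul (f : V p q → A) (x : Vp p) {w : Vq q} (hw : ‖w‖ = 1) {s : ℝ} (hs : s ≠ 0) :
    Dslice p q ξ f (x, s • w)
      = ∑ i, εp p q ξ i * fderiv ℝ f (x, s • w) (Pi.single i 1, 0)
        + ωCl p q ξ w * fderiv ℝ f (x, s • w) (0, w) := by
  have h0 : ((0 : Vp p), ‖s • w‖⁻¹ • s • w) = (‖s • w‖⁻¹ * s) • ((0 : Vp p), w) := by
    simp [smul_smul]
  have h1 : (‖s • w‖⁻¹ * s) * (‖s • w‖⁻¹ * s) = 1 := by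
    rw [norm_smul, hw, mul_one, Real.norm_eq_abs]
    have : |s| ≠ 0 := abs_ne_zero.mpr hs
    field_simp
    simp
  simp only [Dslice, pdV1]
  rw [h0, map_smul, smul_smul, ωCl_smul, smul_mul_smul_comm, h1, one_smul]

theorem dualRadon_Dslice [CompleteSpace A] {f : V p q → A} (hf : ContDiff ℝ 1 f) {z : V p q}
    (hz : z.2 ≠ 0) :
    dualRadon p q (Dslice p q ξ f) z = DV p q ξ (fun y => dualRadon p q f y) z := by
  have hc : Continuous fun w : sphere (0 : Vq q) 1 =>
      (fderiv ℝ f (lineProj w z)).comp (lineProj (w : Vq q)) := by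
    have hl : Continuous fun w : sphere (0 : Vq q) 1 => lineProj (p := p) (w : Vq q) :=
      continuous_lineProj.comp continuous_subtype_val
    exact ((hf.continuous_fderiv one_ne_zero).comp (hl.clm_apply continuous_const)).clm_comp hl
  have hI : Integrable (fun w : sphere (0 : Vq q) 1 =>
      (fderiv ℝ f (lineProj w z)).comp (lineProj (w : Vq q))) (sphMeasure q) :=
    hc.integrable_of_hasCompactSupport (HasCompactSupport.of_compactSpace _)
  have hIv (v : V p q) : Integrable (fun w : sphere (0 : Vq q) 1 =>
      fderiv ℝ f (lineProj w z) (lineProj (w : Vq q) v)) (sphMeasure q) := hI.apply_continuousLinearMap v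
  have hfd := (hasFDerivAt_dualRadon hf z).fderiv
  simp only [DV, pdV1, pdV2]
  rw [show (fun y => dualRadon p q f y) = dualRadon p q f from rfl, hfd]
  simp only [smul_apply, ContinuousLinearMap.integral_apply hI,
    ContinuousLinearMap.comp_apply, mul_smul_comm, ← Finset.smul_sum, ← smul_add,
    ← integral_const_mul_of_integrable (hIv _)]
  rw [← integral_finsetSum _ fun i _ => (hIv _).const_mul _,
    ← integral_finsetSum _ fun i _ => (hIv _).const_mul _,
    ← integral_add (integrable_finsetSum _ fun i _ => (hIv _).const_mul _)
      (integrable_finsetSum _ fun i _ => (hIv _).const_mul _), dualRadon, average_eq]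
  congr 1
  refine integral_congr_ae ?_
  filter_upwards [ae_inner_ne_zero hz] with w hw
  rw [Dslice_smul ξ f z.1 (by simp) hw, ωCl_mul_eq_sum]
  have h0 (c : ℝ) : ((0 : Vp p), c • (w : Vq q)) = c • ((0 : Vp p), (w : Vq q)) := by simp
  simp only [lineProj_apply, inner_zero_right, zero_smul, EuclideanSpace.inner_single_right, h0,
    map_smul]
  simp

/-- The Radon transform may be differentiated under the integral sign. -/
theorem hasFDerivAt_radon {f : V p q → A} (hf : ContDiff ℝ 1 f) (w : Vq q) (zz : Sl p)
    (hint : Integrable (fun u : (ℝ ∙ w)ᗮ => f (zz.1, zz.2 • w + (u : Vq q))))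
    (hdom : ∃ ε > 0, ∃ g : (ℝ ∙ w)ᗮ → ℝ, Integrable g ∧
        ∀ z' : Sl p, dist z' zz < ε → ∀ u : (ℝ ∙ w)ᗮ,
            (∀ i : Fin (p + 1), ‖pdV1 p q i f (z'.1, z'.2 • w + (u : Vq q))‖ ≤ g u) ∧
            (∀ j : Fin q, ‖pdV2 p q j f (z'.1, z'.2 • w + (u : Vq q))‖ ≤ g u)) :
    Integrable (fun u : (ℝ ∙ w)ᗮ => (fderiv ℝ f (zz.1, zz.2 • w + (u : Vq q))).comp
        (sliceMap w)) ∧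
    HasFDerivAt (fun y : Sl p => radon p q f y.1 y.2 w)
      (∫ u : (ℝ ∙ w)ᗮ, (fderiv ℝ f (zz.1, zz.2 • w + (u : Vq q))).comp
        (sliceMap w)) zz := by
  obtain ⟨ε, hε, g, hg, hle⟩ := hdom
  have hcont (y : Sl p) : Continuous fun u : (ℝ ∙ w)ᗮ => (y.1, y.2 • w + (u : Vq q)) := by
    fun_prop
  have hmeas : AEStronglyMeasurable (fun u : (ℝ ∙ w)ᗮ =>
      (fderiv ℝ f (zz.1, zz.2 • w + (u : Vq q))).comp (sliceMap w)) :=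
    (((hf.continuous_fderiv one_ne_zero).comp (hcont zz)).clm_comp
      continuous_const).aestronglyMeasurable
  have hbound (u : (ℝ ∙ w)ᗮ) (y : Sl p) (hy : y ∈ ball zz ε) :
      ‖(fderiv ℝ f (y.1, y.2 • w + (u : Vq q))).comp (sliceMap w)‖ ≤ ((p + 1 + q) * g u) * ‖(sliceMap w : Sl p →L[ℝ] V p q)‖ := by
    obtain ⟨h1, h2⟩ := hle y hy u
    have h0 : 0 ≤ g u := (norm_nonneg _).trans (h1 0)
    refine (ContinuousLinearMap.opNorm_comp_le _ _).trans ?_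
    gcongr
    exact ContinuousLinearMap.opNorm_le_bound _ (by positivity)
      (norm_apply_le_of_basis_le _ h1 h2)
  have hgI : Integrable fun u : (ℝ ∙ w)ᗮ => ((p + 1 + q) * g u) * ‖(sliceMap w : Sl p →L[ℝ] V p q)‖ :=
    (hg.const_mul _).mul_const _
  refine ⟨hgI.mono' hmeas (.of_forall fun u => hbound u zz (mem_ball_self hε)), ?_⟩
  refine hasFDerivAt_integral_of_dominated_of_fderiv_le
    (F := fun (y : Sl p) (u : (ℝ ∙ w)ᗮ) => f (y.1, y.2 • w + (u : Vq q)))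
    (F' := fun y u => (fderiv ℝ f (y.1, y.2 • w + (u : Vq q))).comp (sliceMap w))
    (ball_mem_nhds zz hε)
    (.of_forall fun y => (hf.continuous.comp (hcont y)).aestronglyMeasurable) hint hmeas
    (.of_forall hbound) hgI (.of_forall fun u y _ => ?_)
  have hsh : HasFDerivAt (fun y : Sl p => ((y.1, y.2 • w + (u : Vq q)) : V p q)) (sliceMap w) y := by
    have := (sliceMap w).hasFDerivAt (x := y) |>.add_const ((0 : Vp p), (u : Vq q))
    refine this.congr_of_eventuallyEq (.of_forall fun y => ?_)
    simp
  exact (hf.differentiable one_ne_zero _).hasFDerivAt.comp y hsh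

/-- Tangential derivatives of an integrable function integrate to zero over a hyperplane. -/
theorem integral_fderiv_tangential_eq_zero {f : V p q → A} (hf : Differentiable ℝ f)
    (w : Vq q) (x : Vp p) (r : ℝ) (t : (ℝ ∙ w)ᗮ)
    (hint : Integrable (fun u : (ℝ ∙ w)ᗮ => f (x, r • w + (u : Vq q))))
    (hint' : Integrable (fun u : (ℝ ∙ w)ᗮ =>
      fderiv ℝ f (x, r • w + (u : Vq q)) (0, (t : Vq q)))) :
    ∫ u : (ℝ ∙ w)ᗮ, fderiv ℝ f (x, r • w + (u : Vq q)) (0, (t : Vq q)) = 0 := by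
  refine integral_hasLineDerivAt_eq_zero volume (v := t) hint hint' fun u => ?_
  have h := (hf (x, r • w + (u : Vq q))).hasFDerivAt.hasLineDerivAt (0, (t : Vq q))
  simpa [HasLineDerivAt, add_assoc] using h

theorem radon_DV [CompleteSpace A] {f : V p q → A} (hf : ContDiff ℝ 1 f) {w : Vq q}
    (hw : ‖w‖ = 1) (zz : Sl p)
    (hint : Integrable (fun u : (ℝ ∙ w)ᗮ => f (zz.1, zz.2 • w + (u : Vq q))))
    (hintP : ∀ i : Fin (p + 1),
      Integrable (fun u : (ℝ ∙ w)ᗮ => pdV1 p q i f (zz.1, zz.2 • w + (u : Vq q))))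
    (hintQ : ∀ j : Fin q,
      Integrable (fun u : (ℝ ∙ w)ᗮ => pdV2 p q j f (zz.1, zz.2 • w + (u : Vq q))))
    (hdom : ∃ ε > 0, ∃ g : (ℝ ∙ w)ᗮ → ℝ, Integrable g ∧
        ∀ z' : Sl p, dist z' zz < ε → ∀ u : (ℝ ∙ w)ᗮ,
            (∀ i : Fin (p + 1), ‖pdV1 p q i f (z'.1, z'.2 • w + (u : Vq q))‖ ≤ g u) ∧
            (∀ j : Fin q, ‖pdV2 p q j f (z'.1, z'.2 • w + (u : Vq q))‖ ≤ g u)) :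
    radon p q (DV p q ξ f) zz.1 zz.2 w
      = DP p q ξ (fun y : Sl p => radon p q f y.1 y.2 w) zz
        + ωCl p q ξ w * pdr p (fun y : Sl p => radon p q f y.1 y.2 w) zz := by
  obtain ⟨hI, hfd⟩ := hasFDerivAt_radon hf w zz hint hdom
  have hIv (v : Vq q) : Integrable (fun u : (ℝ ∙ w)ᗮ =>
      fderiv ℝ f (zz.1, zz.2 • w + (u : Vq q)) (0, v)) := by
    simp_rw [apply_inr_eq_sum _ v]
    exact integrable_finsetSum _ fun j _ => (hintQ j).smul (v j)
  have hnormal (j : Fin q) :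
      ∫ u : (ℝ ∙ w)ᗮ, pdV2 p q j f (zz.1, zz.2 • w + (u : Vq q))
        = w j • ∫ u : (ℝ ∙ w)ᗮ, fderiv ℝ f (zz.1, zz.2 • w + (u : Vq q)) (0, w) := by
    have ht : EuclideanSpace.single j (1 : ℝ) - w j • w ∈ (ℝ ∙ w)ᗮ := by
      rw [Submodule.mem_orthogonal_singleton_iff_inner_right]
      simp [inner_sub_right, inner_smul_right, hw, EuclideanSpace.inner_single_right]
    have h0 := integral_fderiv_tangential_eq_zero (hf.differentiable one_ne_zero) w zz.1 zz.2
      ⟨_, ht⟩ hint (hIv _)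
    rw [← integral_smul, ← sub_eq_zero, ← integral_sub (hintQ j) ((hIv w).fun_smul (w j)), ← h0]
    refine integral_congr_ae (.of_forall fun u => ?_)
    simp only [pdV2, ← map_smul, ← map_sub]
    simp
  have hP (i : Fin (p + 1)) : pdSl p i (fun y : Sl p => radon p q f y.1 y.2 w) zz
      = ∫ u : (ℝ ∙ w)ᗮ, pdV1 p q i f (zz.1, zz.2 • w + (u : Vq q)) := by
    rw [pdSl, hfd.fderiv, ContinuousLinearMap.integral_apply hI]
    simp [pdV1]
  have hr : pdr p (fun y : Sl p => radon p q f y.1 y.2 w) zz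
      = ∫ u : (ℝ ∙ w)ᗮ, fderiv ℝ f (zz.1, zz.2 • w + (u : Vq q)) (0, w) := by
    rw [pdr, hfd.fderiv, ContinuousLinearMap.integral_apply hI]
    simp
  rw [DP, hr, ωCl_mul_eq_sum]
  simp only [hP, ← hnormal]
  simp only [radon, DV]
  rw [integral_add (integrable_finsetSum _ fun i _ => (hintP i).const_mul _)
      (integrable_finsetSum _ fun j _ => (hintQ j).const_mul _),
    integral_finsetSum _ fun i _ => (hintP i).const_mul _,
    integral_finsetSum _ fun j _ => (hintQ j).const_mul _]
  simp only [integral_const_mul_of_integrable (hintP _), integral_const_mul_of_integrable (hintQ _)]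

end GPS

/-- Lemma 5.1.  For real analytic functions `f : ℝ^{p+q+1} → ℝ_{p+q}` with suitable
integrability, the Radon transform `R` and its dual `Ř` intertwine the Dirac-type
operators: `Ř[D_ω f] = D_𝐱 Ř[f]` and `R[D_𝐱 f] = D_ω R[f]`, where
`D_ω = D_{𝐱_p} + ω ∂_r`. -/
theorem radon_intertwining
    (p q : ℕ) (hq : 1 ≤ q) {A : Type*} [NormedRing A] [NormedAlgebra ℝ A]
    [CompleteSpace A]
    (ξ : A ≃ₐ[ℝ] Cl (p + q))
    (f : V p q → A) (hf : AnalyticOnNhd ℝ f Set.univ)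
    -- suitable integrability: `f` and its first partial derivatives are integrable on
    -- every affine hyperplane `⟨𝐱_q, ω⟩ = r` ...
    (hint : ∀ w ∈ S q, ∀ (x : Vp p) (r : ℝ),
      Integrable (fun u : ((Submodule.span ℝ {w})ᗮ : Submodule ℝ (Vq q)) =>
        f (x, r • w + (u : Vq q))) ∧
      (∀ i : Fin (p + 1),
        Integrable (fun u : ((Submodule.span ℝ {w})ᗮ : Submodule ℝ (Vq q)) =>
          pdV1 p q i f (x, r • w + (u : Vq q)))) ∧
      (∀ j : Fin q,
        Integrable (fun u : ((Submodule.span ℝ {w})ᗮ : Submodule ℝ (Vq q)) =>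
          pdV2 p q j f (x, r • w + (u : Vq q)))))
    -- ... locally uniformly dominated by a fixed integrable function
    (hdom : ∀ w ∈ S q, ∀ z : Sl p, ∃ ε > 0,
      ∃ g : ((Submodule.span ℝ {w})ᗮ : Submodule ℝ (Vq q)) → ℝ, Integrable g ∧
        ∀ z' : Sl p, dist z' z < ε →
          ∀ u : ((Submodule.span ℝ {w})ᗮ : Submodule ℝ (Vq q)),
            ‖f (z'.1, z'.2 • w + (u : Vq q))‖ ≤ g u ∧
            (∀ i : Fin (p + 1), ‖pdV1 p q i f (z'.1, z'.2 • w + (u : Vq q))‖ ≤ g u) ∧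
            (∀ j : Fin q, ‖pdV2 p q j f (z'.1, z'.2 • w + (u : Vq q))‖ ≤ g u)) :
    (∀ z : V p q, z.2 ≠ 0 →
      dualRadon p q (Dslice p q ξ f) z = DV p q ξ (fun y => dualRadon p q f y) z) ∧
    (∀ w ∈ S q, ∀ zz : Sl p,
      radon p q (DV p q ξ f) zz.1 zz.2 w
        = DP p q ξ (fun y : Sl p => radon p q f y.1 y.2 w) zz
          + ωCl p q ξ w * pdr p (fun y : Sl p => radon p q f y.1 y.2 w) zz) := by
  have hf1 : ContDiff ℝ 1 f := contDiffOn_univ.mp (hf.contDiffOn uniqueDiffOn_univ)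
  refine ⟨fun z hz => dualRadon_Dslice ξ hf1 hz, fun w hw zz => ?_⟩
  obtain ⟨h0, hP, hQ⟩ := hint w hw zz.1 zz.2
  obtain ⟨ε, hε, g, hg, hle⟩ := hdom w hw zz
  exact radon_DV ξ hf1 (norm_eq_one_of_mem_S hw) zz h0 hP hQ
    ⟨ε, hε, g, hg, fun z' hz' u => (hle z' hz' u).2⟩
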